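/- Assume Z_{Σ,Θ} ≠ ∅, ker(G) = {0}, and ran(G) ∩ 𝔥₁ = {0}. Define Σ_Θ := Σ₀ − ΘΣ_* on dom(Σ_Θ) := {ψ ∈ dom(S^×) : Σ_*ψ ∈ dom(Θ)}. Then: (i) for every φ ∈ dom(Θ) and every z ∈ ϱ(H), (Θ + M_z)φ = −Σ_Θ G_z φ; (ii) H_Θ = S^×|ker(Σ_Θ), and H_Θ is a self-adjoint extension of S := H|ker(Σ); (iii) for every z ∈ ϱ(H) ∩ ϱ(H_Θ), (−H_Θ + z)⁻¹ = R_z − G_z(Σ_Θ G_z)⁻¹G*_{z̄}. -/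

import Mathlib

noncomputable section

open scoped ComplexInnerProductSpace
open ContinuousLinearMap Filter

variable {F X : Type*}
  [NormedAddCommGroup F] [InnerProductSpace ℂ F] [CompleteSpace F]
  [NormedAddCommGroup X] [InnerProductSpace ℂ X] [CompleteSpace X]

/-- `W R l z = 1 + (z - l) • R`; the point `z` belongs to the resolvent set of the
self-adjoint operator `H` iff `W R l z` is boundedly invertible, where
`R = (-H + λ₀)⁻¹` and `l = λ₀ ∈ ϱ(H) ∩ ℝ` encode `H`. -/
def W (R : F →L[ℂ] F) (l : ℝ) (z : ℂ) : F →L[ℂ] F := 1 + (z - (l : ℂ)) • R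

/-- The resolvent set `ϱ(H)` of `H`, encoded through `R = (-H + λ₀)⁻¹`. -/
def res (R : F →L[ℂ] F) (l : ℝ) : Set ℂ := {z | IsUnit (W R l z)}

/-- The resolvent `R_z = (-H + z)⁻¹`. -/
def Rz (R : F →L[ℂ] F) (l : ℝ) (z : ℂ) : F →L[ℂ] F := R ∘L Ring.inverse (W R l z)

/-- `G_z = (Σ R_z̄)*`, where the bounded operator `B = Σ ∘ R : 𝔉 →L 𝔛` encodes the
(graph-norm bounded) operator `Σ : 𝔥₁ → 𝔛`. -/
def Gz (R : F →L[ℂ] F) (B : F →L[ℂ] X) (l : ℝ) (z : ℂ) : X →L[ℂ] F :=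
  adjoint (B ∘L Ring.inverse (W R l (starRingEnd ℂ z)))

/-- `(-H + λ₀) ψ`, for `ψ ∈ dom H = ran R`. -/
def Hinv (R : F →L[ℂ] F) (ψ : F) : F := Function.invFun (⇑R) ψ

/-- `Σ ψ`, for `ψ ∈ dom H = ran R`. -/
def SigmaOf (R : F →L[ℂ] F) (B : F →L[ℂ] X) (ψ : F) : X := B (Hinv R ψ)

/-- `Q` is the resolvent `(-K + z)⁻¹` of the (in general unbounded) operator `K`. -/
def IsResolventAt (K : F →ₗ.[ℂ] F) (z : ℂ) (Q : F →L[ℂ] F) : Prop :=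
  (∀ ψ : F, Q ψ ∈ K.domain) ∧
  (∀ (ψ : F) (h : Q ψ ∈ K.domain), z • Q ψ - K ⟨Q ψ, h⟩ = ψ) ∧
  (∀ ψ : K.domain, Q (z • (ψ : F) - K ψ) = (ψ : F))

/-- The resolvent set of the (in general unbounded) operator `K`. -/
def pres (K : F →ₗ.[ℂ] F) : Set ℂ := {z | ∃ Q : F →L[ℂ] F, IsResolventAt K z Q}

/-- `J ∈ B(𝔛)` is a two-sided bounded inverse of `Θ + M` (with domain `dom Θ`). -/
def IsBoundedInvOf (Θ : X →ₗ.[ℂ] X) (M : X → X) (J : X →L[ℂ] X) : Prop :=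
  (∀ y : X, J y ∈ Θ.domain) ∧
  (∀ (y : X) (h : J y ∈ Θ.domain), Θ ⟨J y, h⟩ + M (J y) = y) ∧
  (∀ x : Θ.domain, J (Θ x + M (x : X)) = (x : X))

/-- The set `Z_{Σ,Θ} = {z ∈ ϱ(H) : Θ + M_z` has a bounded inverse in `B(𝔛)}`,
where `M_z = Σ (G - G_z)`. -/
def ZSet (R : F →L[ℂ] F) (B : F →L[ℂ] X) (l : ℝ) (Θ : X →ₗ.[ℂ] X) : Set ℂ :=
  {z | z ∈ res R l ∧ ∃ J : X →L[ℂ] X,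
    IsBoundedInvOf Θ (fun x => SigmaOf R B ((Gz R B l l - Gz R B l z) x)) J}

/-- `Hθ` is the self-adjoint operator provided by the Kreĭn-type resolvent formula:
`ϱ(H) ∩ ϱ(H_Θ) = Z_{Σ,Θ}` and `(-H_Θ + z)⁻¹ = R_z + G_z (Θ + M_z)⁻¹ G_z̄*` on `Z_{Σ,Θ}`. -/
def IsKreinOp (R : F →L[ℂ] F) (B : F →L[ℂ] X) (l : ℝ) (Θ : X →ₗ.[ℂ] X)
    (Hθ : F →ₗ.[ℂ] F) : Prop :=
  IsSelfAdjoint Hθ ∧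
  ZSet R B l Θ = res R l ∩ pres Hθ ∧
  ∀ z ∈ ZSet R B l Θ, ∀ J : X →L[ℂ] X,
    IsBoundedInvOf Θ (fun x => SigmaOf R B ((Gz R B l l - Gz R B l z) x)) J →
    IsResolventAt Hθ z
      (Rz R l z + Gz R B l z ∘L J ∘L adjoint (Gz R B l (starRingEnd ℂ z)))

lemma Hinv_apply
    {E : Type*} [NormedAddCommGroup E] [InnerProductSpace ℂ E]
    {R : E →L[ℂ] E} (hinj : Function.Injective ⇑R) (χ : E) :
    Hinv R (R χ) = χ :=
  Function.leftInverse_invFun hinj χ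

lemma SigmaOf_apply
    {E : Type*} [NormedAddCommGroup E] [InnerProductSpace ℂ E]
    {Y : Type*} [NormedAddCommGroup Y] [InnerProductSpace ℂ Y]
    {R : E →L[ℂ] E} (hinj : Function.Injective ⇑R) (B : E →L[ℂ] Y) (χ : E) :
    SigmaOf R B (R χ) = B χ := by
  rw [SigmaOf, Hinv_apply hinj]

lemma W_apply
    {E : Type*} [NormedAddCommGroup E] [InnerProductSpace ℂ E]
    (R : E →L[ℂ] E) (l : ℝ) (z : ℂ) (f : E) :
    W R l z f = f + (z - (l : ℂ)) • R f := by
  simp [W]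

lemma W_self
    {E : Type*} [NormedAddCommGroup E] [InnerProductSpace ℂ E]
    (R : E →L[ℂ] E) (l : ℝ) : W R l l = 1 := by
  simp [W]

lemma adjoint_W {R : F →L[ℂ] F} (hR : IsSelfAdjoint R) (l : ℝ) (z : ℂ) :
    adjoint (W R l z) = W R l (starRingEnd ℂ z) := by
  rw [← star_eq_adjoint, W, W, star_add, star_one, star_smul, hR.star_eq]
  simp

lemma Gz_self (R : F →L[ℂ] F) (B : F →L[ℂ] X) (l : ℝ) : Gz R B l l = adjoint B := by
  rw [Gz, Complex.conj_ofReal, W_self, Ring.inverse_one]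
  rfl

lemma Gz_eq_inverse_comp {R : F →L[ℂ] F} (hR : IsSelfAdjoint R) (B : F →L[ℂ] X) (l : ℝ) (z : ℂ) :
    Gz R B l z = Ring.inverse (W R l z) ∘L adjoint B := by
  rw [Gz, adjoint_comp, ← star_eq_adjoint (Ring.inverse _), ← Ring.inverse_star,
    star_eq_adjoint, adjoint_W hR, Complex.conj_conj]

lemma W_inverse_apply
    {E : Type*} [NormedAddCommGroup E] [InnerProductSpace ℂ E]
    {R : E →L[ℂ] E} {l : ℝ} {z : ℂ} (hz : z ∈ res R l) (f : E) :
    W R l z (Ring.inverse (W R l z) f) = f :=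
  DFunLike.congr_fun (Ring.mul_inverse_cancel _ hz) f

lemma inverse_W_apply
    {E : Type*} [NormedAddCommGroup E] [InnerProductSpace ℂ E]
    {R : E →L[ℂ] E} {l : ℝ} {z : ℂ} (hz : z ∈ res R l) (f : E) :
    Ring.inverse (W R l z) (W R l z f) = f :=
  DFunLike.congr_fun (Ring.inverse_mul_cancel _ hz) f

lemma adjoint_Gz_conj (R : F →L[ℂ] F) (B : F →L[ℂ] X) (l : ℝ) (z : ℂ) :
    adjoint (Gz R B l (starRingEnd ℂ z)) = B ∘L Ring.inverse (W R l z) := by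
  rw [Gz, adjoint_adjoint, Complex.conj_conj]

lemma Gz_self_eq {R : F →L[ℂ] F} (hR : IsSelfAdjoint R) (B : F →L[ℂ] X) {l : ℝ} {z : ℂ}
    (hz : z ∈ res R l) (φ : X) :
    Gz R B l l φ = Gz R B l z φ + R ((z - (l : ℂ)) • Gz R B l z φ) := by
  rw [map_smul, ← W_apply, Gz_self, Gz_eq_inverse_comp hR, comp_apply, W_inverse_apply hz]

lemma SigmaOf_Gz_self_sub {R : F →L[ℂ] F} (hR : IsSelfAdjoint R)
    (hinj : Function.Injective ⇑R) (B : F →L[ℂ] X) {l : ℝ} {z : ℂ} (hz : z ∈ res R l) (φ : X) :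
    SigmaOf R B ((Gz R B l l - Gz R B l z) φ) = B ((z - (l : ℂ)) • Gz R B l z φ) := by
  rw [sub_apply, Gz_self_eq hR B hz, add_sub_cancel_left, SigmaOf_apply hinj]

lemma SigmaOf_Gz_sub_self {R : F →L[ℂ] F} (hR : IsSelfAdjoint R)
    (hinj : Function.Injective ⇑R) (B : F →L[ℂ] X) {l : ℝ} {z : ℂ} (hz : z ∈ res R l) (φ : X) :
    SigmaOf R B ((Gz R B l z - Gz R B l l) φ)
      = -SigmaOf R B ((Gz R B l l - Gz R B l z) φ) := by
  rw [SigmaOf_Gz_self_sub hR hinj B hz, ← map_neg, sub_apply, Gz_self_eq hR B hz,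
    sub_add_cancel_left, ← map_neg, SigmaOf_apply hinj]

/-- Every element of the domain of the Kreĭn operator is `R χ + G φ` with `B χ = Θ φ`. -/
lemma exists_decomposition_of_mem_domain {R : F →L[ℂ] F} {B : F →L[ℂ] X} {l : ℝ}
    (hR : IsSelfAdjoint R) (hinj : Function.Injective ⇑R) {Θ : X →ₗ.[ℂ] X} {Hθ : F →ₗ.[ℂ] F}
    (hZ : (ZSet R B l Θ).Nonempty) (hH : IsKreinOp R B l Θ Hθ) {ψ : F} (hψ : ψ ∈ Hθ.domain) :
    ∃ φ, ∃ hφ : φ ∈ Θ.domain, ∃ χ, ψ = R χ + Gz R B l l φ ∧ B χ = Θ ⟨φ, hφ⟩ := by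
  obtain ⟨z, hz, J, hJ⟩ := hZ
  obtain ⟨-, -, hQ⟩ := hH.2.2 z ⟨hz, J, hJ⟩ J hJ
  have h := hQ ⟨ψ, hψ⟩
  rw [adjoint_Gz_conj] at h
  set g := Ring.inverse (W R l z) (z • ψ - Hθ ⟨ψ, hψ⟩) with hg
  have h' : R g + Gz R B l z (J (B g)) = ψ := h
  refine ⟨J (B g), hJ.1 _, g - (z - (l : ℂ)) • Gz R B l z (J (B g)), ?_, ?_⟩
  · rw [Gz_self_eq hR B hz, map_sub, ← h']
    abel
  · have := hJ.2.1 (B g) (hJ.1 _)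
    beta_reduce at this
    rw [SigmaOf_Gz_self_sub hR hinj B hz] at this
    rw [map_sub, sub_eq_iff_eq_add, this]

/-- `R χ + G φ` with `B χ = Θ φ` lies in the domain of the Kreĭn operator, which acts on it
as `S^×`. -/
lemma exists_mem_domain_of_decomposition {R : F →L[ℂ] F} {B : F →L[ℂ] X} {l : ℝ}
    (hR : IsSelfAdjoint R) (hinj : Function.Injective ⇑R) {Θ : X →ₗ.[ℂ] X} {Hθ : F →ₗ.[ℂ] F}
    (hZ : (ZSet R B l Θ).Nonempty) (hH : IsKreinOp R B l Θ Hθ) {φ : X} (hφ : φ ∈ Θ.domain)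
    {χ : F} (hχ : B χ = Θ ⟨φ, hφ⟩) :
    ∃ h : R χ + Gz R B l l φ ∈ Hθ.domain,
      Hθ ⟨R χ + Gz R B l l φ, h⟩ = (l : ℂ) • (R χ + Gz R B l l φ) - χ := by
  obtain ⟨z, hz, J, hJ⟩ := hZ
  obtain ⟨hQdom, hQ, -⟩ := hH.2.2 z ⟨hz, J, hJ⟩ J hJ
  rw [adjoint_Gz_conj] at hQdom hQ
  set g := χ + (z - (l : ℂ)) • Gz R B l z φ with hg
  have hJg : J (B g) = φ := by
    have := hJ.2.2 ⟨φ, hφ⟩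
    beta_reduce at this
    rwa [SigmaOf_Gz_self_sub hR hinj B hz, ← hχ, ← map_add] at this
  have hψ : R χ + Gz R B l l φ = R g + Gz R B l z φ := by
    rw [Gz_self_eq hR B hz, hg, map_add]
    abel
  have hQψ : (Rz R l z + Gz R B l z ∘L J ∘L B ∘L Ring.inverse (W R l z)) (W R l z g)
      = R χ + Gz R B l l φ := by
    simp only [add_apply, comp_apply, Rz, inverse_W_apply hz, hJg, hψ]
  have hmem := hQdom (W R l z g)
  have hval := hQ (W R l z g) hmem
  simp only [hQψ] at hmem hval
  refine ⟨hmem, ?_⟩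
  rw [sub_eq_iff_eq_add, ← sub_eq_iff_eq_add'] at hval
  rw [← hval, W_apply, hψ, hg]
  module

/-- The component `φ` of an element of `ran R + ran G` is unique. -/
lemma eq_of_sub_Gz_mem_range {R : F →L[ℂ] F} {B : F →L[ℂ] X} {l : ℝ}
    (hkerG : Function.Injective ⇑(Gz R B l l))
    (hranG : Set.range ⇑(Gz R B l l) ∩ Set.range ⇑R = {0}) {ψ : F} {φ φ' : X}
    (h : ψ - Gz R B l l φ ∈ Set.range ⇑R) (h' : ψ - Gz R B l l φ' ∈ Set.range ⇑R) :
    φ = φ' := by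
  obtain ⟨χ, hχ⟩ := h
  obtain ⟨χ', hχ'⟩ := h'
  have hmem : Gz R B l l (φ - φ') ∈ Set.range ⇑(Gz R B l l) ∩ Set.range ⇑R := by
    refine ⟨⟨_, rfl⟩, χ' - χ, ?_⟩
    rw [map_sub, map_sub, hχ, hχ']
    abel
  rw [hranG, Set.mem_singleton_iff] at hmem
  exact sub_eq_zero.mp (hkerG (hmem.trans (map_zero _).symm))

/-- With `Σ_Θ := Σ₀ - Θ Σ_*` on `{ψ ∈ dom S^× : Σ_* ψ ∈ dom Θ}`:
(i) for every `φ ∈ dom Θ` and `z ∈ ϱ(H)`, `G_z φ ∈ dom Σ_Θ` and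
`(Θ + M_z) φ = - Σ_Θ G_z φ` (note `Σ₀ (G_z φ) = Σ ((G_z - G) φ)`, `Σ_* (G_z φ) = φ`);
(ii) `H_Θ = S^×|ker Σ_Θ` and `H_Θ` is a self-adjoint extension of `S = H|ker Σ`;
(iii) `(-H_Θ + z)⁻¹ = R_z - G_z (Σ_Θ G_z)⁻¹ G_z̄*` for `z ∈ ϱ(H) ∩ ϱ(H_Θ)`. -/
theorem statement6
    (R : F →L[ℂ] F) (B : F →L[ℂ] X) (l : ℝ)
    (hR : IsSelfAdjoint R) (hinj : Function.Injective ⇑R)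
    (Θ : X →ₗ.[ℂ] X) (hΘ : IsSelfAdjoint Θ)
    (hZ : (ZSet R B l Θ).Nonempty)
    (hkerG : Function.Injective ⇑(Gz R B l l))
    (hranG : Set.range ⇑(Gz R B l l) ∩ Set.range ⇑R = {0}) :
    (∀ z ∈ res R l, ∀ φ : Θ.domain,
      (Gz R B l z (φ : X) - Gz R B l l (φ : X) ∈ Set.range ⇑R) ∧
      Θ φ + SigmaOf R B ((Gz R B l l - Gz R B l z) (φ : X))
        = -(SigmaOf R B ((Gz R B l z - Gz R B l l) (φ : X)) - Θ φ)) ∧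
    (∀ Hθ : F →ₗ.[ℂ] F, IsKreinOp R B l Θ Hθ →
      ((Hθ.domain : Set F)
          = {ψ | ∃ φ, ∃ hφ : φ ∈ Θ.domain, ψ - Gz R B l l φ ∈ Set.range ⇑R ∧
              SigmaOf R B (ψ - Gz R B l l φ) - Θ ⟨φ, hφ⟩ = 0} ∧
        (∀ (ψ : Hθ.domain) (φ : X), φ ∈ Θ.domain →
          (ψ : F) - Gz R B l l φ ∈ Set.range ⇑R →
          Hθ ψ = (l : ℂ) • (ψ : F) - Hinv R ((ψ : F) - Gz R B l l φ)) ∧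
        (∀ χ : F, B χ = 0 →
          ∃ h : R χ ∈ Hθ.domain, Hθ ⟨R χ, h⟩ = (l : ℂ) • R χ - χ)) ∧
      (∀ z ∈ res R l ∩ pres Hθ, ∀ K : X →L[ℂ] X,
        ((∀ y : X, K y ∈ Θ.domain) ∧
         (∀ (y : X) (h : K y ∈ Θ.domain),
           SigmaOf R B ((Gz R B l z - Gz R B l l) (K y)) - Θ ⟨K y, h⟩ = y) ∧
         (∀ x : Θ.domain,
           K (SigmaOf R B ((Gz R B l z - Gz R B l l) (x : X)) - Θ x) = (x : X))) →
        IsResolventAt Hθ z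
          (Rz R l z - Gz R B l z ∘L K ∘L adjoint (Gz R B l (starRingEnd ℂ z))))) := by
  refine ⟨fun z hz φ => ⟨?_, ?_⟩, fun Hθ hH => ⟨⟨?_, ?_, ?_⟩, ?_⟩⟩
  · refine ⟨-((z - (l : ℂ)) • Gz R B l z φ), ?_⟩
    rw [Gz_self_eq hR B hz, map_neg, sub_add_cancel_left]
  · rw [SigmaOf_Gz_sub_self hR hinj B hz]
    abel
  · ext ψ
    constructor
    · intro hψ
      obtain ⟨φ, hφ, χ, rfl, hχ⟩ := exists_decomposition_of_mem_domain hR hinj hZ hH hψ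
      refine ⟨φ, hφ, ?_⟩
      rw [add_sub_cancel_right, SigmaOf_apply hinj, hχ, sub_self]
      exact ⟨⟨χ, rfl⟩, rfl⟩
    · rintro ⟨φ, hφ, ⟨χ, hχ⟩, h⟩
      rw [← hχ, SigmaOf_apply hinj, sub_eq_zero] at h
      rw [← sub_add_cancel ψ (Gz R B l l φ), ← hχ]
      exact (exists_mem_domain_of_decomposition hR hinj hZ hH hφ h).1
  · rintro ⟨ψ, hψ⟩ φ - hmem
    obtain ⟨φ', hφ', χ, rfl, hχ⟩ := exists_decomposition_of_mem_domain hR hinj hZ hH hψ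
    obtain rfl : φ = φ' :=
      eq_of_sub_Gz_mem_range hkerG hranG hmem ⟨χ, (add_sub_cancel_right _ _).symm⟩
    obtain ⟨_, hval⟩ := exists_mem_domain_of_decomposition hR hinj hZ hH hφ' hχ
    rw [hval, add_sub_cancel_right, Hinv_apply hinj]
  · intro χ hχ
    have hzero : B χ = Θ ⟨0, Θ.domain.zero_mem⟩ := hχ.trans Θ.map_zero.symm
    simpa using exists_mem_domain_of_decomposition hR hinj hZ hH Θ.domain.zero_mem hzero
  · rintro z hz K ⟨hKdom, hKright, hKleft⟩
    have hJ : IsBoundedInvOf Θ (fun x => SigmaOf R B ((Gz R B l l - Gz R B l z) x)) (-K) := by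
      refine ⟨fun y => Θ.domain.neg_mem (hKdom y), fun y h => ?_, fun x => ?_⟩
      · have hK := hKright y (hKdom y)
        have hΘneg : Θ ⟨(-K) y, h⟩ = -Θ ⟨K y, hKdom y⟩ := Θ.map_neg ⟨K y, hKdom y⟩
        beta_reduce
        rw [SigmaOf_Gz_self_sub hR hinj B hz.1, hΘneg]
        rw [SigmaOf_Gz_sub_self hR hinj B hz.1, SigmaOf_Gz_self_sub hR hinj B hz.1] at hK
        rw [neg_apply, map_neg, smul_neg, map_neg]
        rwa [add_comm, ← sub_eq_add_neg]
      · have hK := hKleft x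
        rw [SigmaOf_Gz_sub_self hR hinj B hz.1] at hK
        rw [neg_apply, ← map_neg, neg_add_rev, ← sub_eq_add_neg]
        exact hK
    have hres := hH.2.2 z (hH.2.1 ▸ hz) (-K) hJ
    rwa [neg_comp, comp_neg, ← sub_eq_add_neg] at hres
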